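/- Let (X,d,m) be an isotropic PI space. Fix a set E ⊆ X of finite perimeter and a Borel set B ⊆ X. Suppose {F,G} is a partition of E into two sets of finite perimeter such that P(E,B) = P(F,B) + P(G,B). Then P(A,B) = P(A ∩ F, B) + P(A ∩ G, B) for every set A ⊆ E of finite perimeter. -/

import Mathlib

open MeasureTheory Metric Filter Set
open scoped ENNReal NNReal Topology

namespace PaperBV

noncomputable section

variable {X : Type*} [MetricSpace X]

/-- `f` is locally Lipschitz on `Ω`. -/
def LocLipOn (Ω : Set X) (f : X → ℝ) : Prop :=
  ∀ x ∈ Ω, ∃ K : ℝ≥0, ∃ t ∈ 𝓝[Ω] x, LipschitzOnWith K f t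

/-- The local Lipschitz constant (slope) `lip f` of a function, with value `0` at
points that are not accumulation points (there the filter `𝓝[≠] x` is trivial). -/
def lipConst (f : X → ℝ) (x : X) : ℝ≥0∞ :=
  Filter.limsup (fun y => ENNReal.ofReal (|f y - f x| / dist y x)) (𝓝[≠] x)

variable [MeasurableSpace X]

/-- Convergence `fn → f` in `L¹_loc(μ⌊Ω)`. -/
def TendstoL1loc (μ : Measure X) (Ω : Set X) (fn : ℕ → X → ℝ) (f : X → ℝ) : Prop :=
  ∀ K : Set X, IsCompact K → K ⊆ Ω →
    Filter.Tendsto (fun n => ∫⁻ x in K, ENNReal.ofReal |fn n x - f x| ∂μ)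
      Filter.atTop (𝓝 0)

/-- The total variation `|Df|(Ω)` of `f` on an open set `Ω`, defined by relaxation of the
integral of the local Lipschitz constant along locally Lipschitz approximations. -/
def tvOpen (μ : Measure X) (f : X → ℝ) (Ω : Set X) : ℝ≥0∞ :=
  sInf { a : ℝ≥0∞ | ∃ fn : ℕ → X → ℝ, (∀ n, LocLipOn Ω (fn n)) ∧ TendstoL1loc μ Ω fn f ∧
    a = Filter.liminf (fun n => ∫⁻ x in Ω, lipConst (fn n) x ∂μ) Filter.atTop }

/-- The total variation measure `|Df|(B)` of `f` on an arbitrary set, obtained from the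
values on open sets by the Carathéodory construction. -/
def tv (μ : Measure X) (f : X → ℝ) (B : Set X) : ℝ≥0∞ :=
  ⨅ (Ω : Set X) (_ : IsOpen Ω) (_ : B ⊆ Ω), tvOpen μ f Ω

/-- `f` is a function of bounded variation: `f ∈ L¹(μ)` and `|Df|(X) < ∞`. -/
def BVFun (μ : Measure X) (f : X → ℝ) : Prop :=
  MeasureTheory.Integrable f μ ∧ tv μ f Set.univ < ⊤

/-- The perimeter `P(E, B) = |D 1_E|(B)`. -/
def perim (μ : Measure X) (E B : Set X) : ℝ≥0∞ :=
  tv μ (E.indicator fun _ => (1 : ℝ)) B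

/-- `E` is a (Borel) set of finite perimeter. -/
def FinPerim (μ : Measure X) (E : Set X) : Prop :=
  MeasurableSet E ∧ perim μ E Set.univ < ⊤

/-- `μ` is a doubling measure with doubling constant `CD`. -/
def Doubling (μ : Measure X) (CD : ℝ≥0) : Prop :=
  1 ≤ CD ∧ ∀ (x : X) (r : ℝ), 0 < r → μ (ball x (2 * r)) ≤ (CD : ℝ≥0∞) * μ (ball x r)

/-- The mean value `f_{x,r}` of `f` on the ball `B_r(x)`. -/
def ballAvg (μ : Measure X) (f : X → ℝ) (x : X) (r : ℝ) : ℝ :=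
  (∫ y in ball x r, f y ∂μ) / (μ (ball x r)).toReal

/-- The weak `(1,1)`-Poincaré inequality with constants `CP`, `lam`,
for locally Lipschitz functions. -/
def WeakPoincare (μ : Measure X) (CP lam : ℝ) : Prop :=
  ∀ f : X → ℝ, LocLipOn Set.univ f → ∀ (x : X) (r : ℝ), 0 < r →
    ∫⁻ y in ball x r, ENNReal.ofReal |f y - ballAvg μ f x r| ∂μ ≤
      ENNReal.ofReal (CP * r) * ∫⁻ y in ball x (lam * r), lipConst f y ∂μ

/-- A PI space: doubling and supporting a weak `(1,1)`-Poincaré inequality. -/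
def IsPI (μ : Measure X) : Prop :=
  ∃ (CD : ℝ≥0) (CP lam : ℝ), Doubling μ CD ∧ 0 < CP ∧ 1 ≤ lam ∧ WeakPoincare μ CP lam

/-- The pre-measure `H_δ` of the codimension-one Hausdorff measure: infimum over countable
covers by balls of radii at most `δ` of `∑ μ(B_{r_i}(x_i)) / (2 r_i)`. -/
def preH (μ : Measure X) (δ : ℝ) (S : Set X) : ℝ≥0∞ :=
  ⨅ (c : ℕ → X × ℝ) (_ : ∀ i, 0 < (c i).2 ∧ (c i).2 ≤ δ)
    (_ : S ⊆ ⋃ i, ball (c i).1 (c i).2),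
    ∑' i, μ (ball (c i).1 (c i).2) / ENNReal.ofReal (2 * (c i).2)

/-- The codimension-one Hausdorff measure `H = lim_{δ ↓ 0} H_δ = sup_{δ > 0} H_δ`
(as an outer-measure-type set function). -/
def codimH (μ : Measure X) (S : Set X) : ℝ≥0∞ :=
  ⨆ (δ : ℝ) (_ : 0 < δ), preH μ δ S

/-- The upper density of `E` at `x`. -/
def upperDens (μ : Measure X) (E : Set X) (x : X) : ℝ≥0∞ :=
  Filter.limsup (fun r : ℝ => μ (E ∩ ball x r) / μ (ball x r)) (𝓝[>] (0 : ℝ))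

/-- The essential boundary `∂^e E`. -/
def essBdry (μ : Measure X) (E : Set X) : Set X :=
  {x | 0 < upperDens μ E x ∧ 0 < upperDens μ Eᶜ x}

/-- The essential interior `E^1`: points of density `1`. -/
def essInt (μ : Measure X) (E : Set X) : Set X :=
  {x | Filter.Tendsto (fun r : ℝ => μ (E ∩ ball x r) / μ (ball x r))
    (𝓝[>] (0 : ℝ)) (𝓝 (1 : ℝ≥0∞))}

/-- Integral `∫_S f dν` with respect to an outer-measure-type set function `ν`,
via the layer-cake formula. -/
def outerLint (ν : Set X → ℝ≥0∞) (S : Set X) (f : X → ℝ≥0∞) : ℝ≥0∞ :=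
  ∫⁻ t in Set.Ioi (0 : ℝ), ν {x ∈ S | ENNReal.ofReal t < f x}

/-- `θ` is a family of densities representing the perimeter measures with respect to the
codimension-one Hausdorff measure: `P(E,B) = ∫_{B ∩ ∂^e E} θ_E dH`, with
`γ ≤ θ_E ≤ C` on `∂^e E` for structural constants `0 < γ`, `C < ∞`. -/
def PerimRepr (μ : Measure X) (θ : Set X → X → ℝ≥0∞) : Prop :=
  ∃ γ C : ℝ≥0∞, 0 < γ ∧ C ≠ ⊤ ∧
    ∀ E : Set X, FinPerim μ E →
      (∀ x ∈ essBdry μ E, γ ≤ θ E x ∧ θ E x ≤ C) ∧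
      ∀ B : Set X, MeasurableSet B →
        perim μ E B = outerLint (codimH μ) (B ∩ essBdry μ E) (θ E)

/-- The space is isotropic: the densities `θ_E` can be chosen so that, whenever `F ⊆ E` are
sets of finite perimeter, `θ_F = θ_E` holds `H`-a.e. on `∂^e F ∩ ∂^e E`. -/
def Isotropic (μ : Measure X) : Prop :=
  ∃ θ : Set X → X → ℝ≥0∞, PerimRepr μ θ ∧
    ∀ E F : Set X, FinPerim μ E → FinPerim μ F → F ⊆ E →
      codimH μ {x ∈ essBdry μ F ∩ essBdry μ E | θ F x ≠ θ E x} = 0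

/-- Property (1.2): `H(∂^e E ∩ ∂^e F ∩ ∂^e (E ∪ F)) = 0` for disjoint sets of finite
perimeter. -/
def Prop12 (μ : Measure X) : Prop :=
  ∀ E F : Set X, FinPerim μ E → FinPerim μ F → Disjoint E F →
    codimH μ (essBdry μ E ∩ essBdry μ F ∩ essBdry μ (E ∪ F)) = 0

/-- `E` is decomposable in `B`: `E ∩ B` admits a partition into two sets of finite perimeter
and positive measure such that the perimeter in `B` is additive. -/
def DecomposableIn (μ : Measure X) (E B : Set X) : Prop :=
  ∃ F G : Set X, FinPerim μ F ∧ FinPerim μ G ∧ Disjoint F G ∧ F ∪ G = E ∩ B ∧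
    0 < μ F ∧ 0 < μ G ∧ perim μ E B = perim μ F B + perim μ G B

/-- `E` is a set of finite perimeter which is indecomposable in `B`. -/
def IndecomposableIn (μ : Measure X) (E B : Set X) : Prop :=
  FinPerim μ E ∧ ¬ DecomposableIn μ E B

/-- `E` is an indecomposable set (of finite perimeter). -/
def Indecomposable (μ : Measure X) (E : Set X) : Prop :=
  IndecomposableIn μ E Set.univ

/-- `E` is a simple set. -/
def SimpleSet (μ : Measure X) (E : Set X) : Prop :=
  FinPerim μ E ∧ μ E < ⊤ ∧
  ∀ F : Set X, FinPerim μ F → codimH μ (essBdry μ F \ essBdry μ E) = 0 →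
    μ F = 0 ∨ μ Fᶜ = 0 ∨ μ (symmDiff F E) = 0 ∨ μ (symmDiff F Eᶜ) = 0

end

variable {X : Type*} [MetricSpace X] [CompleteSpace X] [TopologicalSpace.SeparableSpace X]
  [MeasurableSpace X] [BorelSpace X]

section CodimH

variable {X : Type*} [MetricSpace X] [MeasurableSpace X] {μ : Measure X}

theorem preH_le_tsum {δ : ℝ} {S : Set X} {c : ℕ → X × ℝ}
    (hc : ∀ i, 0 < (c i).2 ∧ (c i).2 ≤ δ) (hS : S ⊆ ⋃ i, ball (c i).1 (c i).2) :
    preH μ δ S ≤ ∑' i, μ (ball (c i).1 (c i).2) / ENNReal.ofReal (2 * (c i).2) :=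
  (iInf_le _ c).trans ((iInf_le _ hc).trans (iInf_le _ hS))

theorem exists_cover_of_preH_lt {δ : ℝ} {S : Set X} {a : ℝ≥0∞} (h : preH μ δ S < a) :
    ∃ c : ℕ → X × ℝ, (∀ i, 0 < (c i).2 ∧ (c i).2 ≤ δ) ∧ (S ⊆ ⋃ i, ball (c i).1 (c i).2) ∧
      ∑' i, μ (ball (c i).1 (c i).2) / ENNReal.ofReal (2 * (c i).2) < a := by
  simpa only [preH, iInf_lt_iff, exists_prop] using h

theorem preH_mono {δ : ℝ} {S T : Set X} (h : S ⊆ T) : preH μ δ S ≤ preH μ δ T :=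
  le_iInf fun _ => le_iInf fun hc => le_iInf fun hT => preH_le_tsum hc (h.trans hT)

theorem preH_anti {δ δ' : ℝ} {S : Set X} (h : δ ≤ δ') : preH μ δ' S ≤ preH μ δ S :=
  le_iInf fun _ => le_iInf fun hc => le_iInf fun hS =>
    preH_le_tsum (fun i => ⟨(hc i).1, (hc i).2.trans h⟩) hS

theorem preH_le_codimH {δ : ℝ} (hδ : 0 < δ) (S : Set X) : preH μ δ S ≤ codimH μ S :=
  le_iSup₂ (f := fun (δ : ℝ) (_ : 0 < δ) => preH μ δ S) δ hδ

theorem codimH_mono {S T : Set X} (h : S ⊆ T) : codimH μ S ≤ codimH μ T :=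
  iSup₂_mono fun _ _ => preH_mono h

theorem preH_iUnion_le (δ : ℝ) (s : ℕ → Set X) :
    preH μ δ (⋃ i, s i) ≤ ∑' i, preH μ δ (s i) := by
  refine ENNReal.le_of_forall_pos_le_add fun ε hε hfin => ?_
  obtain ⟨ε', hε'pos, hε'⟩ :=
    ENNReal.exists_pos_sum_of_countable' (ENNReal.coe_pos.2 hε).ne' ℕ
  have hlt : ∀ i, preH μ δ (s i) < preH μ δ (s i) + ε' i := fun i =>
    ENNReal.lt_add_right (ENNReal.ne_top_of_tsum_ne_top hfin.ne i) (hε'pos i).ne'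
  choose c hc hcov hsum using fun i => exists_cover_of_preH_lt (hlt i)
  have hcov' : (⋃ i, s i) ⊆
      ⋃ n : ℕ, ball (c n.unpair.1 n.unpair.2).1 (c n.unpair.1 n.unpair.2).2 := by
    refine iUnion_subset fun i x hx => ?_
    obtain ⟨j, hj⟩ := mem_iUnion.1 (hcov i hx)
    exact mem_iUnion.2 ⟨Nat.pair i j, by simpa using hj⟩
  refine (preH_le_tsum (fun n => hc n.unpair.1 n.unpair.2) hcov').trans ?_
  have hre := Nat.pairEquiv.symm.tsum_eq fun p : ℕ × ℕ =>
    μ (ball (c p.1 p.2).1 (c p.1 p.2).2) / ENNReal.ofReal (2 * (c p.1 p.2).2)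
  simp only [Nat.pairEquiv_symm_apply] at hre
  rw [hre, ENNReal.tsum_prod (f := fun i j =>
    μ (ball (c i j).1 (c i j).2) / ENNReal.ofReal (2 * (c i j).2))]
  calc _ ≤ ∑' i, (preH μ δ (s i) + ε' i) := ENNReal.tsum_le_tsum fun i => (hsum i).le
    _ = ∑' i, preH μ δ (s i) + ∑' i, ε' i := ENNReal.tsum_add
    _ ≤ _ := by gcongr

theorem codimH_iUnion_le (s : ℕ → Set X) : codimH μ (⋃ i, s i) ≤ ∑' i, codimH μ (s i) :=
  iSup₂_le fun δ hδ => (preH_iUnion_le δ s).trans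
    (ENNReal.tsum_le_tsum fun i => preH_le_codimH hδ (s i))

/-- The codimension-one Hausdorff measure as an outer measure. The hypothesis is needed since
the covers in `preH` consist of infinitely many nondegenerate balls. -/
noncomputable def codimHOuter (μ : Measure X) (h0 : codimH μ ∅ = 0) : OuterMeasure X where
  measureOf := codimH μ
  empty := h0
  mono := codimH_mono
  iUnion_nat s _ := codimH_iUnion_le s

theorem codimHOuter_apply (h0 : codimH μ ∅ = 0) (S : Set X) :
    codimHOuter μ h0 S = codimH μ S := rfl

open Classical in
theorem preH_add_le {δ : ℝ} (h0 : preH μ δ ∅ = 0) {s t : Set X}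
    (hst : ∀ x ∈ s, ∀ y ∈ t, 2 * δ ≤ dist x y) :
    preH μ δ s + preH μ δ t ≤ preH μ δ (s ∪ t) := by
  refine le_iInf fun c => le_iInf fun hc => le_iInf fun hcov => ?_
  refine ENNReal.le_of_forall_pos_le_add fun ε hε _ => ?_
  have hε2 : (0 : ℝ≥0∞) < ε / 2 := ENNReal.half_pos (ENNReal.coe_pos.2 hε).ne'
  obtain ⟨c', hc', -, hsum'⟩ := exists_cover_of_preH_lt (h0.trans_lt hε2)
  set w : X × ℝ → ℝ≥0∞ := fun p => μ (ball p.1 p.2) / ENNReal.ofReal (2 * p.2) with hw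
  have key : ∀ u : Set X, u ⊆ s ∪ t → preH μ δ u ≤
      ∑' i, (if (ball (c i).1 (c i).2 ∩ u).Nonempty then w (c i) else 0) + ε / 2 := by
    intro u hu
    have hle := preH_le_tsum (μ := μ) (δ := δ) (S := u)
      (c := fun i => if (ball (c i).1 (c i).2 ∩ u).Nonempty then c i else c' i) (by
        intro i
        split_ifs
        exacts [hc i, hc' i]) (by
        intro x hx
        obtain ⟨i, hi⟩ := mem_iUnion.1 (hcov (hu hx))
        refine mem_iUnion.2 ⟨i, ?_⟩
        rwa [if_pos ⟨x, hi, hx⟩])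
    refine hle.trans ((ENNReal.tsum_le_tsum (g := fun i =>
      (if (ball (c i).1 (c i).2 ∩ u).Nonempty then w (c i) else 0) + w (c' i)) ?_).trans ?_)
    · intro i
      by_cases h : (ball (c i).1 (c i).2 ∩ u).Nonempty <;> simp [h, hw]
    · rw [ENNReal.tsum_add]
      gcongr
  calc _ ≤ _ := add_le_add (key s subset_union_left) (key t subset_union_right)
    _ = ∑' i, ((if (ball (c i).1 (c i).2 ∩ s).Nonempty then w (c i) else 0) +
          (if (ball (c i).1 (c i).2 ∩ t).Nonempty then w (c i) else 0)) + ε := by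
        rw [add_add_add_comm, ENNReal.add_halves, ENNReal.tsum_add]
    _ ≤ _ := by
        refine add_le_add_left (ENNReal.tsum_le_tsum fun i => ?_) _
        by_cases hs : (ball (c i).1 (c i).2 ∩ s).Nonempty
        · have ht : ¬ (ball (c i).1 (c i).2 ∩ t).Nonempty := by
            rintro ⟨y, hy, hyt⟩
            obtain ⟨x, hx, hxs⟩ := hs
            have h1 := hst x hxs y hyt
            have h2 := dist_triangle_right x y (c i).1
            rw [mem_ball] at hx hy
            linarith [(hc i).2]
          simp [hs, ht, hw]
        · by_cases ht : (ball (c i).1 (c i).2 ∩ t).Nonempty <;> simp [hs, ht, hw]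

theorem codimHOuter_isMetric (h0 : codimH μ ∅ = 0) : (codimHOuter μ h0).IsMetric := by
  intro s t ⟨r, hr0, hr⟩
  refine le_antisymm (measure_union_le s t) ?_
  simp only [codimHOuter_apply]
  obtain ⟨ρ, hρ0, hρ⟩ : ∃ ρ : ℝ, 0 < ρ ∧ ∀ x ∈ s, ∀ y ∈ t, ρ ≤ dist x y := by
    refine ⟨(min r 1).toReal, ENNReal.toReal_pos (by simp [hr0]) (by simp), ?_⟩
    intro x hx y hy
    rw [dist_edist]
    exact ENNReal.toReal_mono (edist_ne_top x y) ((min_le_left _ _).trans (hr x hx y hy))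
  refine ENNReal.biSup_add_biSup_le' ⟨1, one_pos⟩ ⟨1, one_pos⟩ fun δ₁ h₁ δ₂ h₂ => ?_
  set δ := min (min δ₁ δ₂) (ρ / 2)
  have hδ : 0 < δ := lt_min (lt_min h₁ h₂) (half_pos hρ0)
  have hδρ : δ ≤ ρ / 2 := min_le_right _ _
  have hempty : preH μ δ ∅ = 0 := le_antisymm (h0 ▸ preH_le_codimH hδ ∅) zero_le
  calc _ ≤ preH μ δ s + preH μ δ t := add_le_add
        (preH_anti ((min_le_left _ _).trans (min_le_left _ _)))
        (preH_anti ((min_le_left _ _).trans (min_le_right _ _)))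
    _ ≤ preH μ δ (s ∪ t) :=
        preH_add_le hempty fun x hx y hy => by linarith [hρ x hx y hy]
    _ ≤ _ := preH_le_codimH hδ _

end CodimH

section OuterIntegral

variable {X : Type*} {ν : OuterMeasure X}

theorem outerLint_le_of_null {S T : Set X} {f g : X → ℝ≥0∞}
    (h : ν {x ∈ S | x ∉ T ∨ f x ≠ g x} = 0) : outerLint ν S f ≤ outerLint ν T g := by
  refine lintegral_mono fun t => ?_
  have hsub : {x ∈ S | ENNReal.ofReal t < f x} ⊆
      {x ∈ T | ENNReal.ofReal t < g x} ∪ {x ∈ S | x ∉ T ∨ f x ≠ g x} := by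
    rintro x ⟨hxS, hx⟩
    by_cases hT : x ∈ T ∧ f x = g x
    · exact Or.inl ⟨hT.1, hT.2 ▸ hx⟩
    · exact Or.inr ⟨hxS, by tauto⟩
  calc _ ≤ _ := measure_mono hsub
    _ ≤ _ := measure_union_le _ _
    _ = _ := by rw [h, add_zero]

theorem outerLint_mono {S T : Set X} (f : X → ℝ≥0∞) (h : S ⊆ T) :
    outerLint ν S f ≤ outerLint ν T f :=
  lintegral_mono fun _ => measure_mono fun _ hx => ⟨h hx.1, hx.2⟩

theorem outerLint_inter_add_diff {S M : Set X} (f : X → ℝ≥0∞)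
    (hM : MeasurableSet[ν.caratheodory] M) :
    outerLint ν (S ∩ M) f + outerLint ν (S \ M) f = outerLint ν S f := by
  have hanti : Antitone fun t : ℝ => ν {x ∈ S ∩ M | ENNReal.ofReal t < f x} :=
    fun a b hab => measure_mono fun x hx =>
      ⟨hx.1, (ENNReal.ofReal_le_ofReal hab).trans_lt hx.2⟩
  unfold outerLint
  rw [← lintegral_add_left hanti.measurable]
  refine lintegral_congr fun t => ?_
  rw [(OuterMeasure.isCaratheodory_iff ν).1 hM {x ∈ S | ENNReal.ofReal t < f x}]
  congr 2 <;> ext x <;> simp only [mem_ofPred_eq, mem_inter_iff, Set.mem_sdiff] <;> tauto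

theorem null_of_outerLint_eq_zero {S : Set X} {f : X → ℝ≥0∞} {γ : ℝ≥0∞} (hγ : 0 < γ)
    (hf : ∀ x ∈ S, γ ≤ f x) (h : outerLint ν S f = 0) : ν S = 0 := by
  obtain ⟨c, hc0, hcγ⟩ := ENNReal.lt_iff_exists_nnreal_btwn.1 hγ
  have hc : (0 : ℝ) < c := by exact_mod_cast hc0
  have hle : ∫⁻ _ in Ioc (0 : ℝ) c, ν S ≤ outerLint ν S f := by
    refine (setLIntegral_mono' measurableSet_Ioc fun t ht => measure_mono fun x hx =>
      (⟨hx, ?_⟩ : x ∈ {x ∈ S | ENNReal.ofReal t < f x})).trans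
      (lintegral_mono_set Ioc_subset_Ioi_self)
    calc ENNReal.ofReal t ≤ ENNReal.ofReal c := ENNReal.ofReal_le_ofReal ht.2
      _ = c := ENNReal.ofReal_coe_nnreal
      _ < γ := hcγ
      _ ≤ f x := hf x hx
  rw [h, nonpos_iff_eq_zero, setLIntegral_const, mul_eq_zero] at hle
  refine hle.resolve_right ?_
  simp only [Real.volume_Ioc, sub_zero]
  exact (ENNReal.ofReal_pos.2 hc).ne'

end OuterIntegral

section Density

variable {X : Type*} [MetricSpace X] [MeasurableSpace X] {μ : Measure X}

theorem upperDens_mono {E F : Set X} (h : E ⊆ F) (x : X) : upperDens μ E x ≤ upperDens μ F x :=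
  limsup_le_limsup (Eventually.of_forall fun _ =>
    ENNReal.div_le_div_right (measure_mono (inter_subset_inter_left _ h)) _)

theorem upperDens_eq_zero_iff {E : Set X} {x : X} : upperDens μ E x = 0 ↔
    Tendsto (fun r : ℝ => μ (E ∩ ball x r) / μ (ball x r)) (𝓝[>] (0 : ℝ)) (𝓝 0) :=
  ⟨fun h => tendsto_of_le_liminf_of_limsup_le zero_le h.le, fun h => h.limsup_eq⟩

theorem upperDens_union_eq_zero {E F : Set X} {x : X} (hE : upperDens μ E x = 0)
    (hF : upperDens μ F x = 0) : upperDens μ (E ∪ F) x = 0 := by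
  rw [upperDens_eq_zero_iff] at *
  refine tendsto_of_tendsto_of_tendsto_of_le_of_le tendsto_const_nhds
    (by simpa using hE.add hF) (fun _ => zero_le) fun r => ?_
  beta_reduce
  rw [← ENNReal.add_div, union_inter_distrib_right]
  gcongr
  exact measure_union_le _ _

theorem mem_essBdry_of_disjoint {F G : Set X} (h : Disjoint F G) {x : X}
    (hF : 0 < upperDens μ F x) (hG : 0 < upperDens μ G x) : x ∈ essBdry μ F ∩ essBdry μ G :=
  ⟨⟨hF, hG.trans_le (upperDens_mono h.subset_compl_left x)⟩,
    ⟨hG, hF.trans_le (upperDens_mono h.subset_compl_right x)⟩⟩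

theorem essBdry_union_subset (F G : Set X) :
    essBdry μ (F ∪ G) ⊆ essBdry μ F ∪ essBdry μ G := by
  rintro x ⟨h1, h2⟩
  have hFc := h2.trans_le (upperDens_mono (compl_subset_compl.2 subset_union_left) x)
  have hGc := h2.trans_le (upperDens_mono (compl_subset_compl.2 subset_union_right) x)
  by_cases hF : upperDens μ F x = 0
  · refine Or.inr ⟨pos_iff_ne_zero.2 fun hG => h1.ne' (upperDens_union_eq_zero hF hG), hGc⟩
  · exact Or.inl ⟨pos_iff_ne_zero.2 hF, hFc⟩

theorem essBdry_diff_subset {F G : Set X} (h : Disjoint F G) :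
    essBdry μ F \ essBdry μ G ⊆ essBdry μ (F ∪ G) := by
  rintro x ⟨⟨h1, h2⟩, hG⟩
  refine ⟨h1.trans_le (upperDens_mono subset_union_left x), pos_iff_ne_zero.2 fun h3 => ?_⟩
  have hG0 : upperDens μ G x = 0 := by
    by_contra hne
    exact hG (mem_essBdry_of_disjoint h h1 (pos_iff_ne_zero.2 hne)).2
  have hle := upperDens_mono (μ := μ) (E := Fᶜ) (F := (F ∪ G)ᶜ ∪ G)
    (fun y hy => by by_cases hyG : y ∈ G <;> simp_all) x
  exact (h2.trans_le hle).ne' (upperDens_union_eq_zero h3 hG0)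

/-- For a doubling measure, vanishing of the density can be tested along dyadic radii. -/
theorem upperDens_eq_zero_iff_dyadic {CD : ℝ≥0} (hD : Doubling μ CD) {E : Set X} {x : X} :
    upperDens μ E x = 0 ↔
      limsup (fun n : ℕ => μ (E ∩ ball x ((1 / 2) ^ n)) / μ (ball x ((1 / 2) ^ n))) atTop = 0 := by
  rw [upperDens_eq_zero_iff]
  constructor
  · intro h
    refine (h.comp (tendsto_nhdsWithin_iff.2 ⟨?_, ?_⟩)).limsup_eq
    · exact tendsto_pow_atTop_nhds_zero_of_lt_one (by norm_num) (by norm_num)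
    · exact Eventually.of_forall fun n => mem_Ioi.2 (by positivity)
  · intro h
    have h' := tendsto_of_le_liminf_of_limsup_le (zero_le) h.le
    rw [ENNReal.tendsto_nhds_zero]
    intro ε hε
    have h'' : Tendsto (fun n : ℕ => (CD : ℝ≥0∞) *
        (μ (E ∩ ball x ((1 / 2) ^ n)) / μ (ball x ((1 / 2) ^ n)))) atTop (𝓝 0) := by
      simpa using ENNReal.Tendsto.const_mul h' (Or.inr ENNReal.coe_ne_top)
    obtain ⟨N, hN⟩ := eventually_atTop.1 (ENNReal.tendsto_nhds_zero.1 h'' ε hε)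
    filter_upwards [Ioo_mem_nhdsGT (show (0 : ℝ) < (1 / 2) ^ N by positivity)] with r hr
    obtain ⟨n, hn1, hn2⟩ := exists_nat_pow_near_of_lt_one hr.1
      (hr.2.le.trans (pow_le_one₀ (by norm_num) (by norm_num)))
      (show (0 : ℝ) < 1 / 2 by norm_num) (by norm_num)
    have hNn : N ≤ n := by
      by_contra hlt
      have := pow_le_pow_of_le_one (show (0 : ℝ) ≤ 1 / 2 by norm_num) (by norm_num)
        (show n + 1 ≤ N by omega)
      linarith [hr.2]
    refine le_trans ?_ (hN n hNn)
    have hball : μ (ball x ((1 / 2) ^ n)) ≤ CD * μ (ball x r) := by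
      refine (measure_mono (ball_subset_ball ?_)).trans (hD.2 x r hr.1)
      rw [pow_succ] at hn1
      linarith
    have hCD : (CD : ℝ≥0∞) ≠ 0 := by
      have := hD.1
      exact_mod_cast (zero_lt_one.trans_le this).ne'
    calc μ (E ∩ ball x r) / μ (ball x r)
        = CD * (μ (E ∩ ball x r) / (CD * μ (ball x r))) := by
          rw [div_eq_mul_inv, div_eq_mul_inv, ENNReal.mul_inv (Or.inl hCD)
            (Or.inl ENNReal.coe_ne_top), mul_left_comm, ← mul_assoc (CD : ℝ≥0∞),
            ENNReal.mul_inv_cancel hCD ENNReal.coe_ne_top, one_mul]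
      _ ≤ _ := by gcongr

theorem measurableSet_essBdry [TopologicalSpace.SeparableSpace X] [BorelSpace X]
    [IsLocallyFiniteMeasure μ] {CD : ℝ≥0} (hD : Doubling μ CD) {E : Set X}
    (hE : MeasurableSet E) : MeasurableSet (essBdry μ E) := by
  have : SecondCountableTopology X := UniformSpace.secondCountable_of_separable X
  have hball : ∀ {S : Set X}, MeasurableSet S → ∀ r : ℝ, Measurable fun x => μ (S ∩ ball x r) := by
    intro S hS r
    have hset : MeasurableSet {p : X × X | dist p.2 p.1 < r} :=
      measurableSet_lt (measurable_snd.dist measurable_fst) measurable_const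
    exact measurable_measure_prodMk_left (ν := μ)
      (s := Prod.snd ⁻¹' S ∩ {p : X × X | dist p.2 p.1 < r}) ((measurable_snd hS).inter hset)
  have hball' : ∀ r : ℝ, Measurable fun x => μ (ball x r) := fun r => by
    simpa using hball MeasurableSet.univ r
  have hmeas : ∀ {S : Set X}, MeasurableSet S → MeasurableSet {x | 0 < upperDens μ S x} := by
    intro S hS
    simp only [pos_iff_ne_zero, ne_eq, upperDens_eq_zero_iff_dyadic hD]
    refine MeasurableSet.compl (measurableSet_eq_fun (Measurable.limsup fun n => ?_)
      measurable_const)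
    exact (hball hS _).div (hball' _)
  exact (hmeas hE).inter (hmeas hE.compl)

end Density

section Lip

variable {X : Type*} [MetricSpace X]

theorem LocLipOn.continuous {f : X → ℝ} (hf : LocLipOn univ f) : Continuous f := by
  refine continuous_iff_continuousAt.2 fun x => ?_
  obtain ⟨K, t, ht, hK⟩ := hf x (mem_univ x)
  rw [nhdsWithin_univ] at ht
  exact hK.continuousOn.continuousAt ht

theorem LocLipOn.min {Ω : Set X} {f g : X → ℝ} (hf : LocLipOn Ω f) (hg : LocLipOn Ω g) :
    LocLipOn Ω fun x => min (f x) (g x) := by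
  intro x hx
  obtain ⟨K, t, ht, hK⟩ := hf x hx
  obtain ⟨L, u, hu, hL⟩ := hg x hx
  refine ⟨max K L, t ∩ u, inter_mem ht hu, LipschitzOnWith.of_dist_le_mul fun y hy z hz => ?_⟩
  have h1 := hK.dist_le_mul y hy.1 z hz.1
  have h2 := hL.dist_le_mul y hy.2 z hz.2
  rw [Real.dist_eq] at *
  refine (abs_min_sub_min_le_max _ _ _ _).trans (max_le (h1.trans ?_) (h2.trans ?_))
  · gcongr
    exact_mod_cast le_max_left K L
  · gcongr
    exact_mod_cast le_max_right K L

theorem lipConst_min_le (f g : X → ℝ) (x : X) :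
    lipConst (fun y => min (f y) (g y)) x ≤ lipConst f x + lipConst g x := by
  refine le_trans ?_ (max_le (le_self_add) (le_add_self) :
    max (lipConst f x) (lipConst g x) ≤ _)
  refine le_of_forall_gt fun b hb => ?_
  obtain ⟨c, hc, hcb⟩ := exists_between hb
  refine lt_of_le_of_lt (limsup_le_of_le (by isBoundedDefault) ?_) hcb
  filter_upwards [eventually_lt_of_limsup_lt ((le_max_left _ _).trans_lt hc),
    eventually_lt_of_limsup_lt ((le_max_right _ _).trans_lt hc)] with y h1 h2
  refine le_trans ?_ (max_le h1.le h2.le)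
  rw [← ENNReal.ofReal_max]
  refine ENNReal.ofReal_le_ofReal ?_
  rw [max_div_div_right dist_nonneg]
  exact div_le_div_of_nonneg_right (abs_min_sub_min_le_max _ _ _ _) dist_nonneg

theorem measurable_lipConst [MeasurableSpace X] [BorelSpace X] {f : X → ℝ} (hf : Continuous f) :
    Measurable (lipConst f) := by
  have heq : lipConst f = fun x => ⨅ n : ℕ, ⨆ y ∈ ball x (1 / (n + 1 : ℝ)) ∩ {x}ᶜ,
      ENNReal.ofReal (|f y - f x| / dist y x) := by
    funext x
    have h := (nhdsWithin_hasBasis (nhds_basis_ball_inv_nat_succ (x := x))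
      ({x}ᶜ : Set X)).limsup_eq_iInf_iSup
      (u := fun y => ENNReal.ofReal (|f y - f x| / dist y x))
    simpa only [lipConst, iInf_pos] using h
  rw [heq]
  refine Measurable.iInf fun n => LowerSemicontinuous.measurable ?_
  refine lowerSemicontinuous_iff_isOpen_preimage.2 fun a => ?_
  have hset : (fun x => ⨆ y ∈ ball x (1 / (n + 1 : ℝ)) ∩ {x}ᶜ,
      ENNReal.ofReal (|f y - f x| / dist y x)) ⁻¹' Ioi a =
      ⋃ y, {x | dist y x < 1 / (n + 1 : ℝ) ∧ y ≠ x ∧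
        a < ENNReal.ofReal (|f y - f x| / dist y x)} := by
    ext x
    simp only [mem_preimage, mem_Ioi, lt_iSup_iff, mem_iUnion, mem_ofPred_eq, mem_inter_iff,
      mem_ball, mem_compl_iff, mem_singleton_iff, exists_prop, and_assoc, ne_eq]
  rw [hset]
  refine isOpen_iUnion fun y => isOpen_iff_mem_nhds.2 fun x ⟨h1, h2, h3⟩ => ?_
  have hd : ContinuousAt (fun x => dist y x) x := (continuous_const.dist continuous_id).continuousAt
  have hr : ContinuousAt (fun x => ENNReal.ofReal (|f y - f x| / dist y x)) x :=
    ENNReal.continuous_ofReal.continuousAt.comp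
      (((continuous_const.sub hf).abs.continuousAt).div hd (dist_ne_zero.2 h2))
  filter_upwards [hd.eventually_lt_const h1, isOpen_ne.mem_nhds h2.symm,
    hr.eventually_const_lt h3] with z z1 z2 z3 using ⟨z1, Ne.symm z2, z3⟩

end Lip

section FinitePerimeter

variable {X : Type*} [MetricSpace X] [MeasurableSpace X] {μ : Measure X}

theorem tv_univ (f : X → ℝ) : tv μ f univ = tvOpen μ f univ :=
  le_antisymm ((iInf_le _ univ).trans ((iInf_le _ isOpen_univ).trans (iInf_le _ subset_rfl)))
    (le_iInf fun Ω => le_iInf fun _ => le_iInf fun h => by rw [univ_subset_iff.1 h])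

theorem perim_empty_left (B : Set X) : perim μ ∅ B = 0 := by
  refine le_antisymm ?_ zero_le
  refine (iInf_le _ univ).trans ((iInf_le _ isOpen_univ).trans ((iInf_le _ (subset_univ B)).trans
    (sInf_le ⟨fun _ _ => 0, fun _ x _ => ⟨0, univ, univ_mem, ?_⟩, fun K _ _ => ?_, ?_⟩)))
  · exact (LipschitzWith.const 0).lipschitzOnWith
  · simp
  · have h0 : ∀ x : X, lipConst (fun _ => 0) x = 0 := fun x =>
      le_antisymm (limsup_le_of_le (by isBoundedDefault) (by simp)) zero_le
    simp [h0]

theorem finPerim_empty : FinPerim μ ∅ :=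
  ⟨MeasurableSet.empty, by simp [perim_empty_left]⟩

/-- Finite total variation yields approximations with uniformly bounded energies. -/
theorem exists_bounded_approx {f : X → ℝ} {Ω : Set X} (h : tvOpen μ f Ω < ⊤) :
    ∃ (fn : ℕ → X → ℝ) (C : ℝ≥0∞), C < ⊤ ∧ (∀ n, LocLipOn Ω (fn n)) ∧ TendstoL1loc μ Ω fn f ∧
      ∀ n, ∫⁻ x in Ω, lipConst (fn n) x ∂μ ≤ C := by
  obtain ⟨a, ⟨fn, hlip, hconv, rfl⟩, ha⟩ := sInf_lt_iff.1 h
  obtain ⟨C, haC, hC⟩ := exists_between ha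
  obtain ⟨φ, hφ, hφC⟩ := extraction_of_frequently_atTop (frequently_lt_of_liminf_lt
    (by isBoundedDefault) haC)
  exact ⟨fn ∘ φ, C, hC, fun n => hlip (φ n),
    fun K hK hKΩ => (hconv K hK hKΩ).comp hφ.tendsto_atTop, fun n => (hφC n).le⟩

theorem FinPerim.inter [BorelSpace X] {E F : Set X} (hE : FinPerim μ E) (hF : FinPerim μ F) :
    FinPerim μ (E ∩ F) := by
  refine ⟨hE.1.inter hF.1, ?_⟩
  have hE' := hE.2
  have hF' := hF.2
  rw [perim, tv_univ] at hE' hF' ⊢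
  obtain ⟨f, C, hC, hf, hfE, hfC⟩ := exists_bounded_approx hE'
  obtain ⟨g, D, hD, hg, hgF, hgD⟩ := exists_bounded_approx hF'
  refine lt_of_le_of_lt (b := C + D) ?_ (ENNReal.add_lt_top.2 ⟨hC, hD⟩)
  refine sInf_le_of_le
    ⟨fun n x => min (f n x) (g n x), fun n => (hf n).min (hg n), ?_, rfl⟩ ?_
  · intro K hK hKu
    refine tendsto_of_tendsto_of_tendsto_of_le_of_le tendsto_const_nhds
      (by simpa using (hfE K hK hKu).add (hgF K hK hKu)) (fun _ => zero_le) fun n => ?_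
    have hm : Measurable fun x => ENNReal.ofReal |f n x - E.indicator (fun _ => (1 : ℝ)) x| :=
      ENNReal.measurable_ofReal.comp
        (((hf n).continuous.measurable.sub (measurable_const.indicator hE.1)).abs)
    beta_reduce
    rw [← lintegral_add_left hm]
    refine lintegral_mono fun x => ?_
    have hind : (E ∩ F).indicator (fun _ => (1 : ℝ)) x =
        min (E.indicator (fun _ => 1) x) (F.indicator (fun _ => 1) x) := by
      by_cases h1 : x ∈ E <;> by_cases h2 : x ∈ F <;> simp [h1, h2]
    beta_reduce
    rw [hind, ← ENNReal.ofReal_add (abs_nonneg _) (abs_nonneg _)]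
    exact ENNReal.ofReal_le_ofReal ((abs_min_sub_min_le_max _ _ _ _).trans
      (max_le_add_of_nonneg (abs_nonneg _) (abs_nonneg _)))
  · refine liminf_le_of_le (by isBoundedDefault) fun b hb => ?_
    obtain ⟨n, hn⟩ := hb.exists
    refine hn.trans ((lintegral_mono fun x => lipConst_min_le (f n) (g n) x).trans ?_)
    rw [lintegral_add_left (measurable_lipConst (hf n).continuous)]
    exact add_le_add (hfC n) (hgD n)

/-- If the perimeters are represented by densities, then the codimension-one Hausdorff measure
of the empty set vanishes. -/
theorem PerimRepr.codimH_empty {θ : Set X → X → ℝ≥0∞} (h : PerimRepr μ θ) :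
    codimH μ ∅ = 0 := by
  obtain ⟨γ, C, -, -, h⟩ := h
  have h0 := (h ∅ finPerim_empty).2 ∅ MeasurableSet.empty
  rw [perim_empty_left] at h0
  simpa [outerLint] using h0.symm

end FinitePerimeter

section Additivity

variable {X : Type*} [MetricSpace X] [TopologicalSpace.SeparableSpace X]
  [MeasurableSpace X] [BorelSpace X] {μ : Measure X} [IsLocallyFiniteMeasure μ]

/-- In an isotropic space, the perimeter of a disjoint union is additive in `B` if and only if
the essential boundaries of the two pieces meet in an `H`-negligible subset of `B`. -/
theorem perim_union_eq_add_iff (hPI : IsPI μ) (hIso : Isotropic μ) {B F G : Set X}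
    (hB : MeasurableSet B) (hF : FinPerim μ F) (hG : FinPerim μ G) (hE : FinPerim μ (F ∪ G))
    (hdisj : Disjoint F G) :
    perim μ (F ∪ G) B = perim μ F B + perim μ G B ↔
      codimH μ (B ∩ (essBdry μ F ∩ essBdry μ G)) = 0 := by
  obtain ⟨CD, -, -, hD, -⟩ := hPI
  obtain ⟨θ, hrepr, hiso⟩ := hIso
  have h0 := hrepr.codimH_empty
  obtain ⟨γ, C, hγ, -, hrep⟩ := hrepr
  set ν := codimHOuter μ h0
  have hP : ∀ {E : Set X}, FinPerim μ E → ∀ {S : Set X}, MeasurableSet S →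
      perim μ E S = outerLint ν (S ∩ essBdry μ E) (θ E) := fun hE _ hS => (hrep _ hE).2 _ hS
  have hcar : ∀ {S : Set X}, MeasurableSet S → MeasurableSet[ν.caratheodory] S :=
    fun hS => (codimHOuter_isMetric h0).le_caratheodory _ hS
  have hdF := measurableSet_essBdry hD hF.1
  have hdG := measurableSet_essBdry hD hG.1
  have hsplit : ∀ {E : Set X}, FinPerim μ E → ∀ {S M : Set X}, MeasurableSet S →
      MeasurableSet M → perim μ E (S ∩ M) + perim μ E (S \ M) = perim μ E S := by
    intro E hE S M hS hM
    rw [hP hE hS, hP hE (hS.inter hM), hP hE (hS.diff hM), inter_right_comm,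
      ← inter_sdiff_right_comm, outerLint_inter_add_diff _ (hcar hM)]
  have hisoF : ν {x ∈ essBdry μ F ∩ essBdry μ (F ∪ G) | θ F x ≠ θ (F ∪ G) x} = 0 :=
    hiso _ F hE hF subset_union_left
  have hisoG : ν {x ∈ essBdry μ G ∩ essBdry μ (F ∪ G) | θ G x ≠ θ (F ∪ G) x} = 0 :=
    hiso _ G hE hG subset_union_right
  have hle : ∀ {E₁ E₂ : Set X}, FinPerim μ E₁ → FinPerim μ E₂ → ∀ {T N : Set X}, MeasurableSet T →
      ν N = 0 → (∀ x ∈ T, x ∈ essBdry μ E₁ → x ∈ essBdry μ E₂ ∧ (θ E₁ x ≠ θ E₂ x → x ∈ N)) →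
      perim μ E₁ T ≤ perim μ E₂ T := by
    intro E₁ E₂ h₁ h₂ T N hT hN h
    rw [hP h₁ hT, hP h₂ hT]
    refine outerLint_le_of_null (measure_mono_null ?_ hN)
    rintro x ⟨⟨hxT, hx₁⟩, hx⟩
    obtain ⟨hx₂, hxN⟩ := h x hxT hx₁
    exact hxN (hx.resolve_left fun hn => hn ⟨hxT, hx₂⟩)
  have hzero : ∀ {E₁ : Set X}, FinPerim μ E₁ → ∀ {T : Set X}, MeasurableSet T →
      ν (T ∩ essBdry μ E₁) = 0 → perim μ E₁ T = 0 := by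
    intro E₁ h₁ T hT h
    rw [hP h₁ hT, ← nonpos_iff_eq_zero]
    refine (outerLint_le_of_null (T := ∅) (g := θ E₁)
      (measure_mono_null (fun _ hx => hx.1) h)).trans ?_
    simp [outerLint]
  have hempty : ∀ {S : Set X}, (∀ x, x ∉ S) → ν S = 0 := fun h => by
    rw [eq_empty_of_forall_notMem h, measure_empty]
  have hS : MeasurableSet (B ∩ essBdry μ F ∩ essBdry μ G) := (hB.inter hdF).inter hdG
  have hT₁ : MeasurableSet ((B ∩ essBdry μ F) \ essBdry μ G) := (hB.inter hdF).diff hdG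
  have hT₂ : MeasurableSet (B \ essBdry μ F ∩ essBdry μ G) := (hB.diff hdF).inter hdG
  have hT₃ : MeasurableSet ((B \ essBdry μ F) \ essBdry μ G) := (hB.diff hdF).diff hdG
  have hparts : ∀ {E₁ : Set X}, FinPerim μ E₁ → perim μ E₁ B =
      perim μ E₁ (B ∩ essBdry μ F ∩ essBdry μ G) + perim μ E₁ ((B ∩ essBdry μ F) \ essBdry μ G) +
      (perim μ E₁ (B \ essBdry μ F ∩ essBdry μ G) +
        perim μ E₁ ((B \ essBdry μ F) \ essBdry μ G)) := by
    intro E₁ h₁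
    rw [hsplit h₁ (hB.inter hdF) hdG, hsplit h₁ (hB.diff hdF) hdG, hsplit h₁ hB hdF]
  have hsub : essBdry μ (F ∪ G) ⊆ essBdry μ F ∪ essBdry μ G := essBdry_union_subset F G
  have hFE : essBdry μ F \ essBdry μ G ⊆ essBdry μ (F ∪ G) := essBdry_diff_subset hdisj
  have hGE : essBdry μ G \ essBdry μ F ⊆ essBdry μ (F ∪ G) :=
    union_comm F G ▸ essBdry_diff_subset hdisj.symm
  have hF₁ : perim μ F ((B ∩ essBdry μ F) \ essBdry μ G) =
      perim μ (F ∪ G) ((B ∩ essBdry μ F) \ essBdry μ G) :=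
    le_antisymm
      (hle hF hE hT₁ hisoF fun x hx hxF =>
        ⟨hFE ⟨hxF, hx.2⟩, fun hne => ⟨⟨hxF, hFE ⟨hxF, hx.2⟩⟩, hne⟩⟩)
      (hle hE hF hT₁ hisoF fun x hx hxE =>
        ⟨hx.1.2, fun hne => ⟨⟨hx.1.2, hxE⟩, hne.symm⟩⟩)
  have hG₂ : perim μ G (B \ essBdry μ F ∩ essBdry μ G) =
      perim μ (F ∪ G) (B \ essBdry μ F ∩ essBdry μ G) :=
    le_antisymm
      (hle hG hE hT₂ hisoG fun x hx hxG =>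
        ⟨hGE ⟨hxG, hx.1.2⟩, fun hne => ⟨⟨hxG, hGE ⟨hxG, hx.1.2⟩⟩, hne⟩⟩)
      (hle hE hG hT₂ hisoG fun x hx hxE =>
        ⟨hx.2, fun hne => ⟨⟨hx.2, hxE⟩, hne.symm⟩⟩)
  have hG₁ := hzero hG hT₁ (hempty fun x hx => hx.1.2 hx.2)
  have hF₂ := hzero hF hT₂ (hempty fun x hx => hx.1.1.2 hx.2)
  have hF₃ := hzero hF hT₃ (hempty fun x hx => hx.1.1.2 hx.2)
  have hG₃ := hzero hG hT₃ (hempty fun x hx => hx.1.2 hx.2)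
  have hE₃ := hzero hE hT₃ (hempty fun x hx => (hsub hx.2).elim hx.1.1.2 hx.1.2)
  have hfin : perim μ (F ∪ G) B ≠ ⊤ := by
    refine ne_top_of_le_ne_top hE.2.ne ?_
    rw [hP hE hB, hP hE MeasurableSet.univ]
    exact outerLint_mono _ (inter_subset_inter_left _ (subset_univ B))
  have hEB := hparts hE
  rw [hE₃, add_zero, add_assoc] at hEB
  have hFGB : perim μ F B + perim μ G B =
      perim μ F (B ∩ essBdry μ F ∩ essBdry μ G) + perim μ G (B ∩ essBdry μ F ∩ essBdry μ G) +
      (perim μ (F ∪ G) ((B ∩ essBdry μ F) \ essBdry μ G) +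
        perim μ (F ∪ G) (B \ essBdry μ F ∩ essBdry μ G)) := by
    rw [hparts hF, hparts hG, hF₁, hG₂, hF₂, hF₃, hG₁, hG₃]
    ring
  have hfin' := hfin
  rw [hEB] at hfin'
  rw [hFGB, hEB, ENNReal.add_left_inj (ENNReal.add_ne_top.1 hfin').2, ← inter_assoc]
  constructor
  · intro hadd
    have hEF : perim μ (F ∪ G) (B ∩ essBdry μ F ∩ essBdry μ G) ≤
        perim μ F (B ∩ essBdry μ F ∩ essBdry μ G) :=
      hle hE hF hS hisoF fun x hx hxE => ⟨hx.1.2, fun hne => ⟨⟨hx.1.2, hxE⟩, hne.symm⟩⟩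
    have hEG : perim μ (F ∪ G) (B ∩ essBdry μ F ∩ essBdry μ G) ≤
        perim μ G (B ∩ essBdry μ F ∩ essBdry μ G) :=
      hle hE hG hS hisoG fun x hx hxE => ⟨hx.2, fun hne => ⟨⟨hx.2, hxE⟩, hne.symm⟩⟩
    have hFS : perim μ F (B ∩ essBdry μ F ∩ essBdry μ G) = 0 := by
      have hS_fin := (ENNReal.add_ne_top.1 hfin').1
      have h := (add_le_add_right hEG (perim μ F (B ∩ essBdry μ F ∩ essBdry μ G))).trans hadd.ge
      refine nonpos_iff_eq_zero.1 ((ENNReal.add_le_add_iff_right hS_fin).1 ?_)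
      simpa using h
    rw [hP hF hS] at hFS
    exact measure_mono_null (μ := ν) (subset_inter subset_rfl fun x hx => hx.1.2)
      (null_of_outerLint_eq_zero hγ (fun x hx => ((hrep F hF).1 x hx.2).1) hFS)
  · intro hnull
    have hz : ∀ {E₁ : Set X}, FinPerim μ E₁ →
        perim μ E₁ (B ∩ essBdry μ F ∩ essBdry μ G) = 0 := fun h₁ =>
      hzero h₁ hS (measure_mono_null (μ := ν) inter_subset_left hnull)
    rw [hz hE, hz hF, hz hG, add_zero]

end Additivity

/-- Perimeter additivity passes to subsets. -/
theorem perim_additive_restrict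
    (μ : Measure X) [IsLocallyFiniteMeasure μ] (hμ : μ ≠ 0)
    (hPI : IsPI μ) (hIso : Isotropic μ)
    (E B F G : Set X) (hE : FinPerim μ E) (hB : MeasurableSet B)
    (hF : FinPerim μ F) (hG : FinPerim μ G)
    (hdisj : Disjoint F G) (hunion : F ∪ G = E)
    (hadd : perim μ E B = perim μ F B + perim μ G B) :
    ∀ A : Set X, A ⊆ E → FinPerim μ A →
      perim μ A B = perim μ (A ∩ F) B + perim μ (A ∩ G) B := by
  intro A hAE hA
  have hAF := hA.inter hF
  have hAG := hA.inter hG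
  have hA_eq : A ∩ F ∪ A ∩ G = A := by
    rw [← inter_union_distrib_left, hunion, inter_eq_left.2 hAE]
  subst hunion
  have hnull := (perim_union_eq_add_iff hPI hIso hB hF hG hE hdisj).1 hadd
  have hres := (perim_union_eq_add_iff hPI hIso hB hAF hAG (hA_eq.symm ▸ hA)
    (hdisj.mono inter_subset_right inter_subset_right)).2 (le_antisymm ?_ zero_le)
  · rwa [hA_eq] at hres
  · refine (codimH_mono ?_).trans hnull.le
    rintro x ⟨hxB, hxF, hxG⟩
    exact ⟨hxB, mem_essBdry_of_disjoint hdisj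
      (hxF.1.trans_le (upperDens_mono inter_subset_right x))
      (hxG.1.trans_le (upperDens_mono inter_subset_right x))⟩

end PaperBV
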